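/- arXiv:1809.05543 — 3 statements merged into one kernel-verified Lean document; each statement's English description precedes it below -/
import Mathlib

section
/- Let (X_α)_{α ∈ 𝔄} be an independent family of complete sub-σ-fields of a probability space (Ω, M, P) and let Z be a complete sub-σ-field of M. Suppose (i) the family (X_α)_{α ∈ 𝔄} is conditionally independent given Z, and (ii) for every α ∈ 𝔄 and every A ∈ X_α, the conditional probability P[A | Z] has an X_α-measurable version. Then (⋁_{α ∈ 𝔄} X_α) ∧ Z = ⋁_{α ∈ 𝔄} (X_α ∧ Z). -/
open MeasureTheory ProbabilityTheory

/-- The σ-field `0_Λ` of `P`-trivial events: events of the ambient σ-field `m` whose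
probability is `0` or `1`. -/
def zeroLambda {Ω : Type*} (m : MeasurableSpace Ω) (P : @MeasureTheory.Measure Ω m) :
    MeasurableSpace Ω :=
  MeasurableSpace.generateFrom {A : Set Ω | MeasurableSet[m] A ∧ (P A = 0 ∨ P A = 1)}

/-- The conditional probability `P[A | W]` of an event `A` given a σ-field `W`,
as a random variable (conditional expectation of the indicator). -/
noncomputable def condProb {Ω : Type*} {m : MeasurableSpace Ω} (P : Measure Ω)
    (W : MeasurableSpace Ω) (A : Set Ω) : Ω → ℝ :=
  P[A.indicator (fun _ => (1 : ℝ)) | W]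

/-- A family `(X_α)` of σ-fields is conditionally independent given `W` if for every
finite subset and every choice of events, the conditional probability of the
intersection is a.s. the product of the conditional probabilities. -/
def CondIIndep {Ω ι : Type*} {m : MeasurableSpace Ω} (P : Measure Ω)
    (W : MeasurableSpace Ω) (X : ι → MeasurableSpace Ω) : Prop :=
  ∀ (s : Finset ι) (f : ι → Set Ω), (∀ i ∈ s, MeasurableSet[X i] (f i)) →
    condProb P W (⋂ i ∈ s, f i) =ᵐ[P] fun ω => ∏ i ∈ s, condProb P W (f i) ω

lemma measurableSet_of_ae_eq {Ω : Type*} {m : MeasurableSpace Ω} {P : Measure Ω}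
    {W : MeasurableSpace Ω} (hWm : W ≤ m) (hW : zeroLambda m P ≤ W) {A B : Set Ω}
    (hA : MeasurableSet[W] A) (hB : MeasurableSet[m] B) (hAB : A =ᵐ[P] B) :
    MeasurableSet[W] B := by
  have null {N : Set Ω} (hN : MeasurableSet[m] N) (h : P N = 0) : MeasurableSet[W] N :=
    hW _ (MeasurableSpace.measurableSet_generateFrom ⟨hN, Or.inl h⟩)
  obtain ⟨h₁, h₂⟩ := ae_eq_set.1 hAB
  have key : B = (A \ (A \ B)) ∪ (B \ A) := by
    ext x
    by_cases x ∈ A <;> by_cases x ∈ B <;> simp_all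
  rw [key]
  exact (hA.diff (null ((hWm _ hA).diff hB) h₁)).union (null (hB.diff (hWm _ hA)) h₂)

lemma measurable_of_ae_eq {Ω : Type*} {m : MeasurableSpace Ω} {P : Measure Ω}
    {W : MeasurableSpace Ω} (hWm : W ≤ m) (hW : zeroLambda m P ≤ W) {f g : Ω → ℝ}
    (hf : Measurable[W] f) (hg : Measurable[m] g) (hfg : f =ᵐ[P] g) :
    Measurable[W] g := by
  intro S hS
  refine measurableSet_of_ae_eq hWm hW (hf hS) (hg hS) ?_
  filter_upwards [hfg] with ω hω
  exact congrArg S hω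

lemma condProb_iUnion_aestronglyMeasurable {Ω : Type*} {m : MeasurableSpace Ω} {P : Measure Ω}
    [IsProbabilityMeasure P] {Y Z : MeasurableSpace Ω} (hYm : Y ≤ m) (hZm : Z ≤ m)
    {f : ℕ → Set Ω} (hd : Pairwise (Function.onFun Disjoint f))
    (hfm : ∀ n, MeasurableSet[m] (f n))
    (hf : ∀ n, AEStronglyMeasurable[Y] (condProb P Z (f n)) P) :
    AEStronglyMeasurable[Y] (condProb P Z (⋃ n, f n)) P := by
  have hint (n : ℕ) : Integrable ((f n).indicator (fun _ => (1 : ℝ))) P :=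
    (integrable_const 1).indicator (hfm n)
  have hacc (n : ℕ) : (Set.accumulate f n).indicator (fun _ => (1 : ℝ))
      = ∑ i ∈ Finset.range (n + 1), (f i).indicator (fun _ => (1 : ℝ)) := by
    have : Set.accumulate f n = ⋃ i ∈ Finset.range (n + 1), f i := by
      ext x; simp [Set.mem_accumulate]
    rw [this, Finset.indicator_biUnion _ _ fun i _ j _ hij => hd hij]
    ext x; simp
  have hpart (n : ℕ) : AEStronglyMeasurable[Y] (condProb P Z (Set.accumulate f n)) P := by
    unfold condProb
    rw [hacc]
    refine AEStronglyMeasurable.congr ?_ (condExp_finsetSum (fun i _ => hint i) Z).symm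
    exact Finset.sum_induction _ (fun u : Ω → ℝ => AEStronglyMeasurable[Y] u P)
      (fun _ _ hu hv => hu.add hv) aestronglyMeasurable_const fun i _ => hf i
  have hlim := tendsto_condExpL1_of_dominated_convergence hZm (μ := P)
    (fs := fun n => (Set.accumulate f n).indicator (fun _ => (1 : ℝ)))
    (f := (⋃ n, f n).indicator (fun _ => (1 : ℝ))) (fun _ => 1)
    (fun n => (stronglyMeasurable_const.indicator
      (MeasurableSet.biUnion (Set.to_countable _) fun i _ => hfm i)).aestronglyMeasurable)
    (integrable_const 1)
    (fun n => ae_of_all _ fun ω => by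
      by_cases h : ω ∈ Set.accumulate f n <;> simp [h])
    (ae_of_all _ fun ω => by
      rw [← Set.iUnion_accumulate]
      exact (Set.monotone_accumulate.tendsto_indicator _ _ _).mono_right (pure_le_nhds _))
  have hmem := (isClosed_aestronglyMeasurable (F := ℝ) (p := 1) (μ := P) hYm).mem_of_tendsto hlim
    (Filter.Eventually.of_forall fun n => (hpart n).congr (condExp_ae_eq_condExpL1 hZm _))
  exact AEStronglyMeasurable.congr hmem (condExp_ae_eq_condExpL1 hZm _).symm

lemma condProb_aestronglyMeasurable_of_iSup {Ω ι : Type*} {m : MeasurableSpace Ω}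
    {P : Measure Ω} [IsProbabilityMeasure P] {X : ι → MeasurableSpace Ω}
    {Y Z : MeasurableSpace Ω} (hXm : ∀ i, X i ≤ m) (hYm : Y ≤ m) (hZm : Z ≤ m)
    (hCI : CondIIndep P Z X)
    (hX : ∀ i A, MeasurableSet[X i] A → AEStronglyMeasurable[Y] (condProb P Z A) P)
    {A : Set Ω} (hA : MeasurableSet[⨆ i, X i] A) :
    AEStronglyMeasurable[Y] (condProb P Z A) P := by
  have hsup : ⨆ i, X i ≤ m := iSup_le hXm
  have hgen : ⨆ i, X i = MeasurableSpace.generateFrom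
      (piiUnionInter (fun i => {s | MeasurableSet[X i] s}) Set.univ) := by
    rw [generateFrom_piiUnionInter_measurableSet X Set.univ]; simp
  induction A, hA using MeasurableSpace.induction_on_inter hgen
      (isPiSystem_piiUnionInter _ (fun i => @MeasurableSpace.isPiSystem_measurableSet Ω (X i)) _) with
  | empty =>
    unfold condProb
    rw [Set.indicator_empty]
    exact (aestronglyMeasurable_const (b := (0 : ℝ))).congr (by rw [condExp_const hZm])
  | basic t ht =>
    obtain ⟨s, -, f, hf, rfl⟩ := ht
    refine AEStronglyMeasurable.congr ?_ (hCI s f hf).symm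
    simp_rw [← Finset.prod_apply]
    exact Finset.prod_induction _ (fun u : Ω → ℝ => AEStronglyMeasurable[Y] u P)
      (fun _ _ hu hv => hu.mul hv) aestronglyMeasurable_const fun i hi => hX i _ (hf i hi)
  | compl t htm ih =>
    have h : condProb P Z tᶜ =ᵐ[P] (fun _ => (1 : ℝ)) - condProb P Z t := by
      unfold condProb
      have hsub := condExp_sub (μ := P) (integrable_const (1 : ℝ))
        ((integrable_const (1 : ℝ)).indicator (hsup _ htm)) Z
      rwa [condExp_const hZm, ← Set.indicator_compl] at hsub
    exact (aestronglyMeasurable_const.sub ih).congr h.symm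
  | iUnion f hd hfm ih =>
    exact condProb_iUnion_aestronglyMeasurable hYm hZm hd (fun n => hsup _ (hfm n)) ih

/-- **Distributivity III.** For an independent family `(X_α)` which is conditionally
independent given `Z`, and such that `P[A|Z]` has an `X_α`-measurable version for each
`A ∈ X_α`, one has `(⋁_α X_α) ∧ Z = ⋁_α (X_α ∧ Z)`. -/
theorem stmt15 {Ω : Type*} {m : MeasurableSpace Ω} (P : Measure Ω) [IsProbabilityMeasure P]
    {𝔄 : Type*} (X : 𝔄 → MeasurableSpace Ω) (Z : MeasurableSpace Ω)
    (hXm : ∀ α, X α ≤ m) (hZm : Z ≤ m)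
    (hXc : ∀ α, zeroLambda m P ≤ X α) (hZc : zeroLambda m P ≤ Z)
    (hInd : iIndep X P)
    (hCI : CondIIndep P Z X)
    (hver : ∀ (α : 𝔄) (A : Set Ω), MeasurableSet[X α] A →
      ∃ g : Ω → ℝ, Measurable[X α] g ∧ condProb P Z A =ᵐ[P] g) :
    ((⨆ α : 𝔄, X α) ⊔ zeroLambda m P) ⊓ Z
      = (⨆ α : 𝔄, (X α ⊓ Z)) ⊔ zeroLambda m P := by
  have hYm : (⨆ α : 𝔄, (X α ⊓ Z)) ⊔ zeroLambda m P ≤ m :=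
    sup_le (iSup_le fun _ => inf_le_right.trans hZm) (hZc.trans hZm)
  apply le_antisymm
  · rcases isEmpty_or_nonempty 𝔄 with h𝔄 | ⟨⟨α₀⟩⟩
    · simp
    rw [sup_eq_left.2 ((hXc α₀).trans (le_iSup X α₀))]
    rintro B ⟨hBX, hBZ⟩
    have hX (α : 𝔄) (A : Set Ω) (hA : MeasurableSet[X α] A) :
        AEStronglyMeasurable[(⨆ α : 𝔄, (X α ⊓ Z)) ⊔ zeroLambda m P] (condProb P Z A) P := by
      obtain ⟨g, hg, hAg⟩ := hver α A hA
      have hgZ : Measurable[Z] g := measurable_of_ae_eq hZm hZc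
        stronglyMeasurable_condExp.measurable (hg.mono (hXm α) le_rfl) hAg
      have hgY : Measurable[(⨆ α : 𝔄, (X α ⊓ Z)) ⊔ zeroLambda m P] g := fun S hS =>
        (le_iSup (fun α => X α ⊓ Z) α).trans le_sup_left _ ⟨hg hS, hgZ hS⟩
      exact ⟨g, hgY.stronglyMeasurable, hAg⟩
    obtain ⟨g, hg, hBg⟩ := condProb_aestronglyMeasurable_of_iSup hXm hYm hZm hCI hX hBX
    have hB : condProb P Z B = B.indicator fun _ => (1 : ℝ) :=
      condExp_of_stronglyMeasurable hZm (stronglyMeasurable_const.indicator hBZ)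
        ((integrable_const 1).indicator (hZm _ hBZ))
    rw [hB] at hBg
    have hBY := measurable_of_ae_eq hYm le_sup_right hg.measurable
      (measurable_const.indicator (hZm _ hBZ)) hBg.symm
    exact (measurable_indicator_const_iff (1 : ℝ)).1 hBY
  · refine sup_le (iSup_le fun α => ?_) (le_inf le_sup_right hZc)
    exact inf_le_inf_right _ ((le_iSup X α).trans le_sup_left)
end

section
/- Let (X_α)_{α ∈ 𝔄} be a family of complete sub-σ-fields of a probability space (Ω, M, P), with 𝔄 containing at least two elements, and let Z be a complete sub-σ-field of M. If the family (X_α)_{α ∈ 𝔄} is conditionally independent given Z, then Z = ⋀_{α ∈ 𝔄} (X_α ∨ Z); in particular ⋀_{α ∈ 𝔄} X_α ⊆ Z. -/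
open MeasureTheory ProbabilityTheory

open Set in
/-- The join of two σ-fields is generated by the π-system of intersections. -/
theorem sup_eq_generateFrom_inter {Ω : Type*} (X Z : MeasurableSpace Ω) :
    X ⊔ Z = MeasurableSpace.generateFrom
      {S | ∃ A C, MeasurableSet[X] A ∧ MeasurableSet[Z] C ∧ S = A ∩ C} := by
  apply le_antisymm
  · refine sup_le (fun A hA => ?_) (fun C hC => ?_)
    · exact .basic _ ⟨A, univ, hA, @MeasurableSet.univ _ Z, (inter_univ A).symm⟩
    · exact .basic _ ⟨univ, C, @MeasurableSet.univ _ X, hC, (univ_inter C).symm⟩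
  · refine MeasurableSpace.generateFrom_le ?_
    rintro _ ⟨A, C, hA, hC, rfl⟩
    exact @MeasurableSet.inter _ (X ⊔ Z) _ _ ((le_sup_left : X ≤ X ⊔ Z) _ hA)
      ((le_sup_right : Z ≤ X ⊔ Z) _ hC)

theorem isPiSystem_measurableSet_inter {Ω : Type*} (X Z : MeasurableSpace Ω) :
    IsPiSystem {S | ∃ A C, MeasurableSet[X] A ∧ MeasurableSet[Z] C ∧ S = A ∩ C} := by
  rintro _ ⟨A, C, hA, hC, rfl⟩ _ ⟨A', C', hA', hC', rfl⟩ -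
  exact ⟨A ∩ A', C ∩ C', @MeasurableSet.inter _ X _ _ hA hA', @MeasurableSet.inter _ Z _ _ hC hC',
    Set.inter_inter_inter_comm A C A' C'⟩

/-- Two integrable functions with equal integrals over a generating π-system and over the whole
space have equal integrals over the generated σ-field. -/
theorem setIntegral_eq_of_isPiSystem {Ω : Type*} {m : MeasurableSpace Ω} {P : Measure Ω}
    {f g : Ω → ℝ} (hf : Integrable f P) (hg : Integrable g P)
    {W : MeasurableSpace Ω} (hW : W ≤ m) {S : Set (Set Ω)}
    (hS : W = MeasurableSpace.generateFrom S) (hpi : IsPiSystem S)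
    (huniv : ∫ x, f x ∂P = ∫ x, g x ∂P)
    (h : ∀ s ∈ S, ∫ x in s, f x ∂P = ∫ x in s, g x ∂P)
    {s : Set Ω} (hs : MeasurableSet[W] s) : ∫ x in s, f x ∂P = ∫ x in s, g x ∂P := by
  induction s, hs using MeasurableSpace.induction_on_inter hS hpi with
  | empty => simp
  | basic t ht => exact h t ht
  | compl t ht ih =>
    rw [setIntegral_compl (hW _ ht) hf, setIntegral_compl (hW _ ht) hg, ih, huniv]
  | iUnion F hd hF ih =>
    rw [integral_iUnion (fun i => hW _ (hF i)) hd hf.integrableOn,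
      integral_iUnion (fun i => hW _ (hF i)) hd hg.integrableOn]
    exact tsum_congr ih

theorem integrable_indicator_one {Ω : Type*} {m : MeasurableSpace Ω} (P : Measure Ω)
    [IsFiniteMeasure P] {A : Set Ω} (hA : MeasurableSet[m] A) :
    Integrable (A.indicator (fun _ => (1 : ℝ))) P :=
  (integrable_const 1).indicator hA

theorem indicator_inter_one_eq_mul {Ω : Type*} (A B : Set Ω) :
    (A ∩ B).indicator (fun _ => (1 : ℝ)) =
      A.indicator (fun _ => (1 : ℝ)) * B.indicator (fun _ => (1 : ℝ)) := by
  ext x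
  simpa using Set.inter_indicator_mul (s := A) (t := B) (fun _ => (1 : ℝ)) (fun _ => 1) x

theorem indicator_one_mul_eq {Ω : Type*} (A : Set Ω) (f : Ω → ℝ) :
    A.indicator (fun _ => (1 : ℝ)) * f = A.indicator f := by
  ext x
  by_cases hx : x ∈ A <;> simp [hx]

theorem integrable_indicator_mul_condProb {Ω : Type*} {m : MeasurableSpace Ω} (P : Measure Ω)
    (W : MeasurableSpace Ω) {A : Set Ω} (hA : MeasurableSet[m] A) (B : Set Ω) :
    Integrable (A.indicator (fun _ => (1 : ℝ)) * condProb P W B) P := by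
  rw [indicator_one_mul_eq]
  exact integrable_condExp.indicator hA

theorem condExp_indicator_mul_condProb {Ω : Type*} {m : MeasurableSpace Ω} (P : Measure Ω)
    [IsFiniteMeasure P] (W : MeasurableSpace Ω) {A : Set Ω} (hA : MeasurableSet[m] A) (B : Set Ω) :
    P[A.indicator (fun _ => (1 : ℝ)) * condProb P W B | W] =ᵐ[P] condProb P W A * condProb P W B :=
  condExp_mul_of_stronglyMeasurable_right stronglyMeasurable_condExp
    (integrable_indicator_mul_condProb P W hA B) (integrable_indicator_one P hA)

/-- If `B` is conditionally independent of `X` given `Z`, then `P[B | X ∨ Z] = P[B | Z]`. -/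
theorem condProb_sup_eq {Ω : Type*} {m : MeasurableSpace Ω} (P : Measure Ω) [IsFiniteMeasure P]
    {X Z : MeasurableSpace Ω} (hX : X ≤ m) (hZ : Z ≤ m) {B : Set Ω} (hB : MeasurableSet[m] B)
    (h : ∀ A, MeasurableSet[X] A → condProb P Z (A ∩ B) =ᵐ[P] condProb P Z A * condProb P Z B) :
    condProb P Z B =ᵐ[P] condProb P (X ⊔ Z) B := by
  have hsm : StronglyMeasurable[X ⊔ Z] (condProb P Z B) :=
    stronglyMeasurable_condExp.mono le_sup_right
  refine ae_eq_condExp_of_forall_setIntegral_eq (sup_le hX hZ) (integrable_indicator_one P hB)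
    (fun _ _ _ => integrable_condExp.integrableOn) (fun E hE _ => ?_)
    hsm.aestronglyMeasurable
  refine setIntegral_eq_of_isPiSystem integrable_condExp (integrable_indicator_one P hB)
    (sup_le hX hZ) (sup_eq_generateFrom_inter X Z) (isPiSystem_measurableSet_inter X Z)
    (integral_condExp hZ) ?_ hE
  rintro _ ⟨A, C, hA, hC, rfl⟩
  have hAm := hX _ hA
  calc ∫ x in A ∩ C, condProb P Z B x ∂P
      = ∫ x in C, (A.indicator (fun _ => (1 : ℝ)) * condProb P Z B) x ∂P := by
        rw [indicator_one_mul_eq, setIntegral_indicator hAm, Set.inter_comm]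
    _ = ∫ x in C, P[A.indicator (fun _ => (1 : ℝ)) * condProb P Z B | Z] x ∂P :=
        (setIntegral_condExp hZ (integrable_indicator_mul_condProb P Z hAm B) hC).symm
    _ = ∫ x in C, condProb P Z (A ∩ B) x ∂P :=
        integral_congr_ae (ae_restrict_of_ae
          ((condExp_indicator_mul_condProb P Z hAm B).trans (h A hA).symm))
    _ = ∫ x in C, (A ∩ B).indicator (fun _ => (1 : ℝ)) x ∂P :=
        setIntegral_condExp hZ (integrable_indicator_one P (hAm.inter hB)) hC
    _ = ∫ x in A ∩ C, B.indicator (fun _ => (1 : ℝ)) x ∂P := by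
        rw [indicator_inter_one_eq_mul, indicator_one_mul_eq, setIntegral_indicator hAm,
          Set.inter_comm]

/-- If `P[B | W] = P[B | Z]` with `Z ⊆ W`, then `B` is conditionally independent of `W`
given `Z`. -/
theorem condProb_inter_of_condProb_eq {Ω : Type*} {m : MeasurableSpace Ω} (P : Measure Ω)
    [IsFiniteMeasure P] {Z W : MeasurableSpace Ω} (hZW : Z ≤ W) (hW : W ≤ m) {A B : Set Ω}
    (hA : MeasurableSet[W] A) (hB : MeasurableSet[m] B) (h : condProb P Z B =ᵐ[P] condProb P W B) :
    condProb P Z (A ∩ B) =ᵐ[P] condProb P Z A * condProb P Z B := by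
  have hAm := hW _ hA
  have hpull : condProb P W (A ∩ B) =ᵐ[P] A.indicator (fun _ => (1 : ℝ)) * condProb P Z B := by
    have hint := integrable_indicator_one P (hAm.inter hB)
    rw [indicator_inter_one_eq_mul] at hint
    have := condExp_mul_of_stronglyMeasurable_left
      (stronglyMeasurable_const.indicator hA) hint (integrable_indicator_one P hB)
    rw [← indicator_inter_one_eq_mul] at this
    exact this.trans ((Filter.EventuallyEq.refl _ _).mul h.symm)
  calc condProb P Z (A ∩ B) =ᵐ[P] P[condProb P W (A ∩ B) | Z] :=
        (condExp_condExp_of_le hZW hW).symm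
    _ =ᵐ[P] P[A.indicator (fun _ => (1 : ℝ)) * condProb P Z B | Z] := condExp_congr_ae hpull
    _ =ᵐ[P] condProb P Z A * condProb P Z B := condExp_indicator_mul_condProb P Z hAm B

/-- A complete σ-field contains every event that is a.s. equal to one of its events. -/
theorem measurableSet_of_zeroLambda_le {Ω : Type*} {m : MeasurableSpace Ω} {P : Measure Ω}
    {Z : MeasurableSpace Ω} (hZ : Z ≤ m) (hZc : zeroLambda m P ≤ Z) {E F : Set Ω}
    (hE : MeasurableSet[m] E) (hF : MeasurableSet[Z] F) (h : E =ᵐ[P] F) : MeasurableSet[Z] E := by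
  have hnull : ∀ N, MeasurableSet[m] N → P N = 0 → MeasurableSet[Z] N := fun N hN h0 =>
    hZc _ (.basic _ ⟨hN, .inl h0⟩)
  have hEF := hnull _ (hE.diff (hZ _ hF)) (ae_le_set.1 h.le)
  have hFE := hnull _ ((hZ _ hF).diff hE) (ae_le_set.1 h.symm.le)
  have : E = (F \ (F \ E)) ∪ (E \ F) := by
    ext x; simp only [Set.mem_union, Set.mem_sdiff]; tauto
  rw [this]
  exact @MeasurableSet.union _ Z _ _ (@MeasurableSet.diff _ Z _ _ hF hFE) hEF

/-- An event with a `Z`-measurable version of its indicator belongs to the complete σ-field `Z`. -/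
theorem measurableSet_of_indicator_ae_eq {Ω : Type*} {m : MeasurableSpace Ω} {P : Measure Ω}
    {Z : MeasurableSpace Ω} (hZ : Z ≤ m) (hZc : zeroLambda m P ≤ Z) {E : Set Ω}
    (hE : MeasurableSet[m] E) {f : Ω → ℝ} (hf : Measurable[Z] f)
    (h : f =ᵐ[P] E.indicator (fun _ => (1 : ℝ))) : MeasurableSet[Z] E := by
  refine measurableSet_of_zeroLambda_le hZ hZc hE (hf (measurableSet_singleton (1 : ℝ))) ?_
  filter_upwards [h] with x hx
  refine propext (?_ : x ∈ E ↔ f x = 1)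
  rw [hx]
  by_cases hxE : x ∈ E <;> simp [hxE]

/-- **Distributivity IV.** If the family `(X_α)` (with at least two indices) is
conditionally independent given `Z`, then `Z = ⋀_α (X_α ∨ Z)`; in particular
`⋀_α X_α ⊆ Z`. -/
theorem stmt16 {Ω : Type*} {m : MeasurableSpace Ω} (P : Measure Ω) [IsProbabilityMeasure P]
    {𝔄 : Type*} [Nontrivial 𝔄] (X : 𝔄 → MeasurableSpace Ω) (Z : MeasurableSpace Ω)
    (hXm : ∀ α, X α ≤ m) (hZm : Z ≤ m)
    (hXc : ∀ α, zeroLambda m P ≤ X α) (hZc : zeroLambda m P ≤ Z)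
    (hCI : CondIIndep P Z X) :
    (Z = ⨅ α : 𝔄, (X α ⊔ Z)) ∧ ((⨅ α : 𝔄, X α) ≤ Z) := by
  classical
  obtain ⟨a, b, hab⟩ := exists_pair_ne 𝔄
  have hpair : ∀ A B, MeasurableSet[X a] A → MeasurableSet[X b] B →
      condProb P Z (A ∩ B) =ᵐ[P] condProb P Z A * condProb P Z B := by
    intro A B hA hB
    have h := hCI {a, b} (fun i => if i = a then A else B) (by simp [hA, hB, hab.symm])
    simp only [Finset.set_biInter_insert, Finset.set_biInter_singleton, Finset.prod_pair hab,
      if_true, if_neg hab.symm] at h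
    exact h
  have key : ⨅ α, (X α ⊔ Z) ≤ Z := by
    intro E hE
    have hEa : MeasurableSet[X a ⊔ Z] E := iInf_le (fun α => X α ⊔ Z) a _ hE
    have hEb : MeasurableSet[X b ⊔ Z] E := iInf_le (fun α => X α ⊔ Z) b _ hE
    have hsa : X a ⊔ Z ≤ m := sup_le (hXm a) hZm
    have hsb : X b ⊔ Z ≤ m := sup_le (hXm b) hZm
    have hEm : MeasurableSet[m] E := hsa _ hEa
    have h := condProb_sup_eq P (hXm b) hZm hEm fun B hB => by
      have hBm := hXm b _ hB
      rw [Set.inter_comm, mul_comm]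
      exact condProb_inter_of_condProb_eq P le_sup_right hsa hEa hBm
        (condProb_sup_eq P (hXm a) hZm hBm fun A hA => hpair A B hA hB)
    have hself : condProb P (X b ⊔ Z) E = E.indicator (fun _ => (1 : ℝ)) :=
      condExp_of_stronglyMeasurable hsb (stronglyMeasurable_const.indicator hEb)
        (integrable_indicator_one P hEm)
    rw [hself] at h
    exact measurableSet_of_indicator_ae_eq hZm hZc hEm stronglyMeasurable_condExp.measurable h
  exact ⟨le_antisymm (le_iInf fun _ => le_sup_right) key,
    (iInf_mono fun _ => le_sup_left).trans key⟩
end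

section
/- Let (X_{αi})_{(α,i) ∈ 𝔄 × {1,2}} be a family of complete sub-σ-fields of a probability space (Ω, M, P), with 𝔄 non-empty, and set X_i := ⋁_{α ∈ 𝔄} X_{αi} for i ∈ {1,2}. Assume that for every finite non-empty A ⊆ 𝔄, X_1 and X_2 are conditionally independent given ⋀_{α ∈ A} X_{α1}, and also conditionally independent given ⋀_{α ∈ A} X_{α2}. Then ⋀_{α ∈ 𝔄} (X_{α1} ∨ X_{α2}) = (⋀_{α ∈ 𝔄} X_{α1}) ∨ (⋀_{α ∈ 𝔄} X_{α2}). -/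
open MeasureTheory ProbabilityTheory

/-- Two σ-fields `A`, `B` are conditionally independent given `W` if
`P[A₀ ∩ B₀ | W] = P[A₀ | W] · P[B₀ | W]` a.s. for all `A₀ ∈ A`, `B₀ ∈ B`. -/
def CondIndepPair {Ω : Type*} {m : MeasurableSpace Ω} (P : Measure Ω)
    (W A B : MeasurableSpace Ω) : Prop :=
  ∀ A₀ B₀ : Set Ω, MeasurableSet[A] A₀ → MeasurableSet[B] B₀ →
    condProb P W (A₀ ∩ B₀) =ᵐ[P] fun ω => condProb P W A₀ ω * condProb P W B₀ ω

section CondProb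

variable {Ω : Type*} {m : MeasurableSpace Ω} {P : Measure Ω}

theorem integrable_indicator_one_s17 [IsProbabilityMeasure P] {S : Set Ω} (hS : MeasurableSet[m] S) :
    Integrable (S.indicator fun _ => (1 : ℝ)) P :=
  (integrable_const 1).indicator hS

theorem integrable_condProb (W : MeasurableSpace Ω) (S : Set Ω) : Integrable (condProb P W S) P :=
  integrable_condExp

theorem stronglyMeasurable_condProb (W : MeasurableSpace Ω) (S : Set Ω) :
    StronglyMeasurable[W] (condProb P W S) :=
  stronglyMeasurable_condExp

theorem norm_condProb_le_one (W : MeasurableSpace Ω) (S : Set Ω) :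
    ∀ᵐ ω ∂P, ‖condProb P W S ω‖ ≤ 1 := by
  have h := ae_bdd_abs_condExp_of_ae_bdd_abs (m := W) (μ := P) (R := (1 : ℝ))
    (f := S.indicator fun _ => (1 : ℝ)) (ae_of_all _ fun ω => by
      by_cases hω : ω ∈ S <;> simp [hω])
  simpa [condProb, Real.norm_eq_abs] using h

/-- A bounded `W`-measurable function is orthogonal to every integrable function whose integral
over each event of `W` vanishes. -/
theorem integral_mul_eq_zero_of_forall_setIntegral_eq_zero [IsProbabilityMeasure P]
    {W : MeasurableSpace Ω} (hW : W ≤ m)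
    {φ v : Ω → ℝ} (hφ : Integrable φ P) (h0 : ∀ H, MeasurableSet[W] H → ∫ ω in H, φ ω ∂P = 0)
    (hv : StronglyMeasurable[W] v) {c : ℝ} (hc : ∀ᵐ ω ∂P, ‖v ω‖ ≤ c) :
    ∫ ω, v ω * φ ω ∂P = 0 := by
  have h1 : (0 : Ω → ℝ) =ᵐ[P] P[φ | W] :=
    ae_eq_condExp_of_forall_setIntegral_eq hW hφ (fun _ _ _ => integrableOn_zero)
      (fun H hH _ => by simp [h0 H hH]) aestronglyMeasurable_zero
  have h2 := condExp_stronglyMeasurable_mul_of_bound hW hv hφ c hc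
  have h3 : P[v * φ | W] =ᵐ[P] 0 := by
    filter_upwards [h1, h2] with ω hω1 hω2
    rw [hω2, Pi.mul_apply, ← hω1]
    simp
  calc ∫ ω, v ω * φ ω ∂P = ∫ ω, (P[v * φ | W]) ω ∂P := (integral_condExp hW).symm
    _ = 0 := by rw [integral_congr_ae h3]; simp

/-- If the integrals of `φ` over all intersections of an event of `A` and an event of `B` vanish,
then so do the integrals over all events of `A ⊔ B`. -/
theorem setIntegral_eq_zero_of_sup {A B : MeasurableSpace Ω} (hA : A ≤ m) (hB : B ≤ m)
    {φ : Ω → ℝ} (hφ : Integrable φ P)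
    (h0 : ∀ a b, MeasurableSet[A] a → MeasurableSet[B] b → ∫ ω in a ∩ b, φ ω ∂P = 0)
    {E : Set Ω} (hE : MeasurableSet[A ⊔ B] E) : ∫ ω in E, φ ω ∂P = 0 := by
  have hgen : A ⊔ B = MeasurableSpace.generateFrom
      {s | ∃ a b, MeasurableSet[A] a ∧ MeasurableSet[B] b ∧ a ∩ b = s} := by
    apply le_antisymm
    · refine sup_le (fun a ha => ?_) (fun b hb => ?_)
      · exact MeasurableSpace.measurableSet_generateFrom
          ⟨a, Set.univ, ha, MeasurableSet.univ, Set.inter_univ a⟩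
      · exact MeasurableSpace.measurableSet_generateFrom
          ⟨Set.univ, b, MeasurableSet.univ, hb, Set.univ_inter b⟩
    · refine MeasurableSpace.generateFrom_le ?_
      rintro _ ⟨a, b, ha, hb, rfl⟩
      exact @MeasurableSet.inter _ (A ⊔ B) _ _ ((le_sup_left : A ≤ A ⊔ B) a ha)
        ((le_sup_right : B ≤ A ⊔ B) b hb)
  have hpi : IsPiSystem {s | ∃ a b, MeasurableSet[A] a ∧ MeasurableSet[B] b ∧ a ∩ b = s} := by
    rintro _ ⟨a, b, ha, hb, rfl⟩ _ ⟨a', b', ha', hb', rfl⟩ -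
    exact ⟨a ∩ a', b ∩ b', ha.inter ha', hb.inter hb', Set.inter_inter_inter_comm _ _ _ _⟩
  have huniv : ∫ ω, φ ω ∂P = 0 := by
    simpa using h0 Set.univ Set.univ MeasurableSet.univ MeasurableSet.univ
  have hle : A ⊔ B ≤ m := sup_le hA hB
  induction E, hE using MeasurableSpace.induction_on_inter hgen hpi with
  | empty => simp
  | basic s hs =>
    obtain ⟨a, b, ha, hb, rfl⟩ := hs
    exact h0 a b ha hb
  | compl s hs ih =>
    have := integral_add_compl (hle s hs) hφ
    linarith
  | iUnion f hd hf ih =>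
    rw [integral_iUnion (fun i => hle _ (hf i)) hd hφ.integrableOn]
    simp [ih]

theorem setIntegral_eq_integral_indicator_mul {S : Set Ω} (hS : MeasurableSet[m] S) (f : Ω → ℝ) :
    ∫ ω in S, f ω ∂P = ∫ ω, S.indicator (fun _ => (1 : ℝ)) ω * f ω ∂P := by
  rw [← integral_indicator hS]
  congr 1
  ext ω
  by_cases hω : ω ∈ S <;> simp [hω]

/-- `∫_S P[T | W] = ∫ P[S | W] P[T | W]`. -/
theorem setIntegral_condProb_eq_integral_mul [IsProbabilityMeasure P]
    {W : MeasurableSpace Ω} (hW : W ≤ m) {S : Set Ω}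
    (hS : MeasurableSet[m] S) (T : Set Ω) :
    ∫ ω in S, condProb P W T ω ∂P = ∫ ω, condProb P W S ω * condProb P W T ω ∂P := by
  have h := condExp_stronglyMeasurable_mul_of_bound hW (stronglyMeasurable_condProb (P := P) W T)
    (integrable_indicator_one_s17 (P := P) hS) 1 (norm_condProb_le_one W T)
  rw [setIntegral_eq_integral_indicator_mul hS]
  calc ∫ ω, S.indicator (fun _ => (1 : ℝ)) ω * condProb P W T ω ∂P
      = ∫ ω, (condProb P W T * S.indicator (fun _ => (1 : ℝ))) ω ∂P := by
        simp only [Pi.mul_apply, mul_comm]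
    _ = _ := (integral_condExp hW).symm
    _ = _ := integral_congr_ae (h.trans (ae_of_all _ fun ω => mul_comm _ _))

theorem setIntegral_condProb_comm [IsProbabilityMeasure P]
    {W : MeasurableSpace Ω} (hW : W ≤ m) {S T : Set Ω}
    (hS : MeasurableSet[m] S) (hT : MeasurableSet[m] T) :
    ∫ ω in S, condProb P W T ω ∂P = ∫ ω in T, condProb P W S ω ∂P := by
  simp only [setIntegral_condProb_eq_integral_mul hW hS, setIntegral_condProb_eq_integral_mul hW hT,
    mul_comm]

theorem setIntegral_indicator_one {S T : Set Ω} (hT : MeasurableSet[m] T) :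
    ∫ ω in S, T.indicator (fun _ => (1 : ℝ)) ω ∂P = P.real (S ∩ T) := by
  rw [setIntegral_indicator hT]
  simp

theorem setIntegral_condProb [IsProbabilityMeasure P]
    {W : MeasurableSpace Ω} (hW : W ≤ m) {S T : Set Ω}
    (hS : MeasurableSet[W] S) (hT : MeasurableSet[m] T) :
    ∫ ω in S, condProb P W T ω ∂P = P.real (S ∩ T) := by
  rw [← setIntegral_indicator_one hT]
  exact setIntegral_condExp hW (integrable_indicator_one_s17 hT) hS

theorem CondIndepPair.symm {W A B : MeasurableSpace Ω} (h : CondIndepPair P W A B) :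
    CondIndepPair P W B A := fun b a hb ha => by
  rw [Set.inter_comm]
  exact (h a b ha hb).trans (ae_of_all _ fun ω => mul_comm _ _)

/-- If `A` and `B` are conditionally independent given `W ≤ B`, then `P[H | W]` is the conditional
probability given `A ⊔ W` of any event `H` of `B`. -/
theorem CondIndepPair.setIntegral_condProb_sup [IsProbabilityMeasure P] {W A B : MeasurableSpace Ω}
    (h : CondIndepPair P W A B) (hWB : W ≤ B) (hA : A ≤ m) (hB : B ≤ m) {E H : Set Ω}
    (hE : MeasurableSet[A ⊔ W] E) (hH : MeasurableSet[B] H) :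
    ∫ ω in E, condProb P W H ω ∂P = P.real (E ∩ H) := by
  have hW := hWB.trans hB
  have key : ∀ a b, MeasurableSet[A] a → MeasurableSet[B] b →
      ∫ ω in a, condProb P W b ω ∂P = P.real (a ∩ b) := fun a b ha hb => by
    rw [setIntegral_condProb_eq_integral_mul hW (hA a ha), ← integral_congr_ae (h a b ha hb),
      ← setIntegral_univ, setIntegral_condProb hW MeasurableSet.univ ((hA a ha).inter (hB b hb)),
      Set.univ_inter]
  have hint := integrable_indicator_one_s17 (P := P) (hB H hH)
  have hz : ∫ ω in E, (condProb P W H - H.indicator (fun _ => (1 : ℝ))) ω ∂P = 0 := by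
    refine setIntegral_eq_zero_of_sup hA hW ((integrable_condProb W H).sub hint)
      (fun a b ha hb => ?_) hE
    simp only [Pi.sub_apply]
    rw [integral_sub (integrable_condProb W H).integrableOn hint.integrableOn,
      setIntegral_indicator_one (hB H hH), Set.inter_assoc, ← key a (b ∩ H) ha
      ((hWB b hb).inter hH), ← setIntegral_indicator (hW b hb), sub_eq_zero]
    refine integral_congr_ae (ae_restrict_of_ae ?_)
    have hc := condExp_indicator (μ := P) hint hb
    rw [Set.indicator_indicator] at hc
    exact hc.symm
  simp only [Pi.sub_apply] at hz
  rw [integral_sub (integrable_condProb W H).integrableOn hint.integrableOn,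
    setIntegral_indicator_one (hB H hH)] at hz
  linarith

theorem CondIndepPair.condProb_ae_eq [IsProbabilityMeasure P] {W A B : MeasurableSpace Ω}
    (h : CondIndepPair P W A B) (hWB : W ≤ B) (hA : A ≤ m) (hB : B ≤ m) {E : Set Ω}
    (hE : MeasurableSet[A ⊔ W] E) : condProb P B E =ᵐ[P] condProb P W E := by
  have hEm : MeasurableSet[m] E := sup_le hA (hWB.trans hB) E hE
  refine (ae_eq_condExp_of_forall_setIntegral_eq hB (integrable_indicator_one_s17 hEm)
    (fun _ _ _ => (integrable_condProb W E).integrableOn) (fun H hH _ => ?_)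
    ((stronglyMeasurable_condProb W E).mono hWB).aestronglyMeasurable).symm
  rw [setIntegral_condProb_comm (hWB.trans hB) (hB H hH) hEm,
    h.setIntegral_condProb_sup hWB hA hB hE hH, setIntegral_indicator_one hEm, Set.inter_comm]

theorem measurableSet_of_ae_eq_s17 {W : MeasurableSpace Ω} (hc : zeroLambda m P ≤ W) (hW : W ≤ m)
    {S T : Set Ω} (hS : MeasurableSet[m] S) (hT : MeasurableSet[W] T) (h : S =ᵐ[P] T) :
    MeasurableSet[W] S := by
  have hnull : ∀ N, MeasurableSet[m] N → P N = 0 → MeasurableSet[W] N := fun N hN h0 =>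
    hc N (MeasurableSpace.measurableSet_generateFrom ⟨hN, Or.inl h0⟩)
  have hST := ae_eq_set.1 h
  have e : S = (T \ (T \ S)) ∪ (S \ T) := by
    ext ω
    by_cases h1 : ω ∈ S <;> by_cases h2 : ω ∈ T <;> simp [h1, h2]
  rw [e]
  exact (hT.diff (hnull _ ((hW T hT).diff hS) hST.2)).union
    (hnull _ (hS.diff (hW T hT)) hST.1)

/-- A measurable function that is a.e. equal to an `X α`-measurable one for each `α` is measurable
for the infimum of the complete σ-fields `X α`. -/
theorem stronglyMeasurable_iInf_of_ae_eq {ι : Type*} {X : ι → MeasurableSpace Ω}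
    (hc : ∀ i, zeroLambda m P ≤ X i) (hX : ∀ i, X i ≤ m) {f : Ω → ℝ} (hf : Measurable[m] f)
    {g : ι → Ω → ℝ} (hg : ∀ i, Measurable[X i] (g i)) (h : ∀ i, f =ᵐ[P] g i) :
    StronglyMeasurable[⨅ i, X i] f := by
  refine Measurable.stronglyMeasurable fun s hs => ?_
  rw [MeasurableSpace.measurableSet_iInf]
  intro i
  refine measurableSet_of_ae_eq_s17 (hc i) (hX i) (hf hs) (hg i hs) ?_
  filter_upwards [h i] with ω hω
  exact congrArg (fun x => x ∈ s) hω

/-- If `A` and `B` are conditionally independent given each of the complete σ-fields `X i ≤ B`,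
then `P[H | ⨅ i, X i]` integrates like the indicator of `H ∈ B` over every event of
`⨅ i, A ⊔ X i`. -/
theorem setIntegral_condProb_iInf [IsProbabilityMeasure P]
    {ι : Type*} [Nonempty ι] {X : ι → MeasurableSpace Ω}
    {A B : MeasurableSpace Ω} (hA : A ≤ m) (hB : B ≤ m) (hXB : ∀ i, X i ≤ B)
    (hc : ∀ i, zeroLambda m P ≤ X i) (h : ∀ i, CondIndepPair P (X i) A B) {E H : Set Ω}
    (hE : ∀ i, MeasurableSet[A ⊔ X i] E) (hH : MeasurableSet[B] H) :
    ∫ ω in E, condProb P (⨅ i, X i) H ω ∂P = P.real (E ∩ H) := by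
  inhabit ι
  have hEm : MeasurableSet[m] E := sup_le hA ((hXB default).trans hB) E (hE default)
  have hYB : ⨅ i, X i ≤ B := (iInf_le X default).trans (hXB default)
  have hsm : StronglyMeasurable[⨅ i, X i] (condProb P B E) :=
    stronglyMeasurable_iInf_of_ae_eq (g := fun i => condProb P (X i) E)
      hc (fun i => (hXB i).trans hB)
      ((stronglyMeasurable_condProb B E).mono hB).measurable
      (fun i => (stronglyMeasurable_condProb (X i) E).measurable)
      (fun i => (h i).condProb_ae_eq (hXB i) hA hB (hE i))
  have hY : condProb P B E =ᵐ[P] condProb P (⨅ i, X i) E := by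
    refine ae_eq_condExp_of_forall_setIntegral_eq (hYB.trans hB) (integrable_indicator_one_s17 hEm)
      (fun _ _ _ => (integrable_condProb B E).integrableOn) (fun K hK _ => ?_)
      hsm.aestronglyMeasurable
    rw [setIntegral_condProb hB (hYB K hK) hEm, setIntegral_indicator_one hEm]
  rw [setIntegral_condProb_comm (hYB.trans hB) hEm (hB H hH),
    ← integral_congr_ae (ae_restrict_of_ae hY), setIntegral_condProb hB hH hEm, Set.inter_comm]

/-- Replacing `G` and then `H` by their conditional probabilities inside `P(F ∩ G ∩ H)` is allowed
as soon as it is allowed for each of them separately. -/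
theorem setIntegral_condProb_mul_condProb [IsProbabilityMeasure P]
    {Y₁ Y₂ A B : MeasurableSpace Ω} (hA : A ≤ m)
    (hB : B ≤ m) (hY₂ : Y₂ ≤ B) {F G H : Set Ω} (hF : MeasurableSet[m] F)
    (hG : MeasurableSet[A] G)
    (h₁ : ∀ H', MeasurableSet[B] H' →
      ∫ ω in F ∩ H', condProb P Y₁ G ω ∂P = P.real (F ∩ H' ∩ G))
    (h₂ : ∫ ω in F ∩ G, condProb P Y₂ H ω ∂P = P.real (F ∩ G ∩ H)) :
    ∫ ω in F, condProb P Y₁ G ω * condProb P Y₂ H ω ∂P = P.real (F ∩ G ∩ H) := by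
  have hGm := hA G hG
  have hint : Integrable (fun ω => condProb P Y₁ G ω - G.indicator (fun _ => (1 : ℝ)) ω) P :=
    (integrable_condProb Y₁ G).sub (integrable_indicator_one_s17 hGm)
  have hbd : ∀ᵐ ω ∂P, ‖condProb P Y₂ H ω‖ ≤ 1 := norm_condProb_le_one Y₂ H
  have hv : StronglyMeasurable[B] (condProb P Y₂ H) := (stronglyMeasurable_condProb Y₂ H).mono hY₂
  have hvm := (hv.mono hB).aestronglyMeasurable (μ := P)
  have h0 := integral_mul_eq_zero_of_forall_setIntegral_eq_zero hB (hint.indicator hF)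
    (fun H' hH' => by
      rw [setIntegral_indicator hF, Set.inter_comm,
        integral_sub (integrable_condProb Y₁ G).integrableOn
          (integrable_indicator_one_s17 hGm).integrableOn, h₁ H' hH', setIntegral_indicator_one hGm,
        sub_self]) hv hbd
  have i₁ : Integrable (fun ω => condProb P Y₁ G ω * condProb P Y₂ H ω) P :=
    (integrable_condProb Y₁ G).mul_bdd hvm hbd
  have i₂ : Integrable (G.indicator (condProb P Y₂ H)) P := (integrable_condProb Y₂ H).indicator hGm
  have e : ∀ ω, condProb P Y₂ H ω * F.indicator
      (fun ω => condProb P Y₁ G ω - G.indicator (fun _ => (1 : ℝ)) ω) ω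
      = F.indicator (fun ω => condProb P Y₁ G ω * condProb P Y₂ H ω
        - G.indicator (condProb P Y₂ H) ω) ω := fun ω => by
    by_cases h1 : ω ∈ F <;> by_cases h2 : ω ∈ G <;> simp [h1, h2] <;> ring
  simp only [e] at h0
  rw [integral_indicator hF, integral_sub i₁.integrableOn i₂.integrableOn,
    setIntegral_indicator hGm, h₂] at h0
  linarith

end CondProb

/-- **Distributivity V.** Let `(X_{α i})` be a doubly-indexed family, `X_i := ⋁_α X_{α i}`.
If for every finite non-empty `A ⊆ 𝔄` the σ-fields `X_1` and `X_2` are conditionally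
independent given `⋀_{α ∈ A} X_{α 1}` and also given `⋀_{α ∈ A} X_{α 2}`, then
`⋀_α (X_{α 1} ∨ X_{α 2}) = (⋀_α X_{α 1}) ∨ (⋀_α X_{α 2})`. -/
theorem stmt17 {Ω : Type*} {m : MeasurableSpace Ω} (P : Measure Ω) [IsProbabilityMeasure P]
    {𝔄 : Type*} [Nonempty 𝔄] (X1 X2 : 𝔄 → MeasurableSpace Ω)
    (hX1m : ∀ α, X1 α ≤ m) (hX2m : ∀ α, X2 α ≤ m)
    (hX1c : ∀ α, zeroLambda m P ≤ X1 α) (hX2c : ∀ α, zeroLambda m P ≤ X2 α)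
    (hCI : ∀ A : Finset 𝔄, A.Nonempty →
      CondIndepPair P (⨅ α ∈ A, X1 α)
        ((⨆ α : 𝔄, X1 α) ⊔ zeroLambda m P) ((⨆ α : 𝔄, X2 α) ⊔ zeroLambda m P) ∧
      CondIndepPair P (⨅ α ∈ A, X2 α)
        ((⨆ α : 𝔄, X1 α) ⊔ zeroLambda m P) ((⨆ α : 𝔄, X2 α) ⊔ zeroLambda m P)) :
    ⨅ α : 𝔄, (X1 α ⊔ X2 α) = (⨅ α : 𝔄, X1 α) ⊔ (⨅ α : 𝔄, X2 α) := by
  inhabit 𝔄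
  refine le_antisymm ?_ (sup_le (le_iInf fun α => (iInf_le X1 α).trans le_sup_left)
    (le_iInf fun α => (iInf_le X2 α).trans le_sup_right))
  have h0m : zeroLambda m P ≤ m := (hX1c default).trans (hX1m default)
  have hCI1 : ∀ α, CondIndepPair P (X1 α) ((⨆ α : 𝔄, X1 α) ⊔ zeroLambda m P)
      ((⨆ α : 𝔄, X2 α) ⊔ zeroLambda m P) := fun α => by
    simpa using (hCI {α} (Finset.singleton_nonempty α)).1
  have hCI2 : ∀ α, CondIndepPair P (X2 α) ((⨆ α : 𝔄, X1 α) ⊔ zeroLambda m P)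
      ((⨆ α : 𝔄, X2 α) ⊔ zeroLambda m P) := fun α => by
    simpa using (hCI {α} (Finset.singleton_nonempty α)).2
  clear hCI
  have hAm : (⨆ α : 𝔄, X1 α) ⊔ zeroLambda m P ≤ m := sup_le (iSup_le hX1m) h0m
  have hBm : (⨆ α : 𝔄, X2 α) ⊔ zeroLambda m P ≤ m := sup_le (iSup_le hX2m) h0m
  have hXA : ∀ α, X1 α ≤ (⨆ α : 𝔄, X1 α) ⊔ zeroLambda m P :=
    fun α => (le_iSup X1 α).trans le_sup_left
  have hXB : ∀ α, X2 α ≤ (⨆ α : 𝔄, X2 α) ⊔ zeroLambda m P :=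
    fun α => (le_iSup X2 α).trans le_sup_left
  generalize (⨆ α : 𝔄, X1 α) ⊔ zeroLambda m P = A at *
  generalize (⨆ α : 𝔄, X2 α) ⊔ zeroLambda m P = B at *
  have hY1 : ⨅ α, X1 α ≤ m := (iInf_le X1 default).trans (hX1m default)
  have hY2 : ⨅ α, X2 α ≤ m := (iInf_le X2 default).trans (hX2m default)
  have hYm : (⨅ α, X1 α) ⊔ (⨅ α, X2 α) ≤ m := sup_le hY1 hY2
  have prod : ∀ F, (∀ α, MeasurableSet[X1 α ⊔ X2 α] F) → ∀ G H, MeasurableSet[A] G →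
      MeasurableSet[B] H → ∫ ω in F, condProb P (⨅ α, X1 α) G ω * condProb P (⨅ α, X2 α) H ω ∂P
        = P.real (F ∩ G ∩ H) := fun F hF G H hG hH => by
    refine setIntegral_condProb_mul_condProb hAm hBm
      ((iInf_le X2 default).trans (hXB default))
      (sup_le (hX1m default) (hX2m default) F (hF default)) hG (fun H' hH' => ?_) ?_
    · refine setIntegral_condProb_iInf hBm hAm hXA hX1c (fun α => (hCI1 α).symm)
        (fun α => ?_) hG
      exact @MeasurableSet.inter _ (B ⊔ X1 α) _ _
        (sup_le (le_sup_right : X1 α ≤ B ⊔ X1 α) ((hXB α).trans le_sup_left) F (hF α))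
        ((le_sup_left : B ≤ B ⊔ X1 α) H' hH')
    · refine setIntegral_condProb_iInf hAm hBm hXB hX2c hCI2 (fun α => ?_) hH
      exact @MeasurableSet.inter _ (A ⊔ X2 α) _ _
        (sup_le ((hXA α).trans le_sup_left) (le_sup_right : X2 α ≤ A ⊔ X2 α) F (hF α))
        ((le_sup_left : A ≤ A ⊔ X2 α) G hG)
  intro F hF
  rw [MeasurableSpace.measurableSet_iInf] at hF
  have hFm : MeasurableSet[m] F := sup_le (hX1m default) (hX2m default) F (hF default)
  have hFAB : MeasurableSet[A ⊔ B] F :=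
    sup_le_sup (hXA default) (hXB default) F (hF default)
  set Y := (⨅ α, X1 α) ⊔ (⨅ α, X2 α) with hY
  have hYX : ∀ α, Y ≤ X1 α ⊔ X2 α := fun α => sup_le_sup (iInf_le X1 α) (iInf_le X2 α)
  have hYAB : Y ≤ A ⊔ B := (hYX default).trans (sup_le_sup (hXA default) (hXB default))
  have hcY : zeroLambda m P ≤ Y := (le_iInf hX1c).trans le_sup_left
  -- `P[F | Y]` and the indicator of `F` have the same integral over the events of `A ⊔ B`.
  have hzero : ∀ G H, MeasurableSet[A] G → MeasurableSet[B] H →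
      ∫ ω in G ∩ H, condProb P Y F ω ∂P = P.real (F ∩ G ∩ H) := fun G H hG hH => by
    have hGH : MeasurableSet[m] (G ∩ H) := (hAm G hG).inter (hBm H hH)
    have i₁ := integrable_indicator_one_s17 (P := P) hGH
    have i₂ : Integrable
        (fun ω => condProb P (⨅ α, X1 α) G ω * condProb P (⨅ α, X2 α) H ω) P :=
      (integrable_condProb _ G).mul_bdd
        (integrable_condProb _ H).aestronglyMeasurable (norm_condProb_le_one _ H)
    have horth := fun K (hK : MeasurableSet[Y] K) => prod K (fun α => hYX α K hK) G H hG hH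
    have h1 := integral_mul_eq_zero_of_forall_setIntegral_eq_zero hYm (i₁.sub i₂)
      (fun K hK => by
        simp only [Pi.sub_apply]
        rw [integral_sub i₁.integrableOn i₂.integrableOn, horth K hK,
          setIntegral_indicator_one hGH, Set.inter_assoc, sub_self])
      (stronglyMeasurable_condProb Y F) (norm_condProb_le_one Y F)
    have hYprod : StronglyMeasurable[Y]
        (fun ω => condProb P (⨅ α, X1 α) G ω * condProb P (⨅ α, X2 α) H ω) :=
      ((stronglyMeasurable_condProb (⨅ α, X1 α) G).mono le_sup_left).mul
        ((stronglyMeasurable_condProb (⨅ α, X2 α) H).mono le_sup_right)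
    have hbd : ∀ᵐ ω ∂P,
        ‖condProb P (⨅ α, X1 α) G ω * condProb P (⨅ α, X2 α) H ω‖ ≤ 1 := by
      filter_upwards [norm_condProb_le_one (P := P) (⨅ α, X1 α) G,
        norm_condProb_le_one (P := P) (⨅ α, X2 α) H] with ω h1 h2
      rw [norm_mul]
      exact mul_le_one₀ h1 (norm_nonneg _) h2
    have j₁ := integrable_indicator_one_s17 (P := P) hFm
    have j₂ := integrable_condProb (P := P) Y F
    have h2 := integral_mul_eq_zero_of_forall_setIntegral_eq_zero hYm (j₁.sub j₂)
      (fun K hK => by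
        simp only [Pi.sub_apply]
        rw [integral_sub j₁.integrableOn j₂.integrableOn, setIntegral_condProb hYm hK hFm,
          setIntegral_indicator_one hFm, sub_self]) hYprod hbd
    have bF : ∀ᵐ ω ∂P, ‖F.indicator (fun _ => (1 : ℝ)) ω‖ ≤ 1 := ae_of_all _ fun ω => by
      by_cases hω : ω ∈ F <;> simp [hω]
    rw [← prod F hF G H hG hH, setIntegral_eq_integral_indicator_mul hGH,
      setIntegral_eq_integral_indicator_mul hFm]
    simp only [Pi.sub_apply, mul_sub] at h1 h2
    rw [integral_sub (i₁.bdd_mul j₂.aestronglyMeasurable (norm_condProb_le_one Y F))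
      (i₂.bdd_mul j₂.aestronglyMeasurable (norm_condProb_le_one Y F))] at h1
    rw [integral_sub (j₁.bdd_mul i₂.aestronglyMeasurable hbd)
      (j₂.bdd_mul i₂.aestronglyMeasurable hbd)] at h2
    simp only [mul_comm (condProb P Y F _)] at h1
    simp only [mul_comm (F.indicator _ _)]
    linarith
  have hae : condProb P Y F =ᵐ[P] F.indicator fun _ => (1 : ℝ) := by
    have hABm : A ⊔ B ≤ m := sup_le hAm hBm
    have j₁ := integrable_indicator_one_s17 (P := P) hFm
    have j₂ := integrable_condProb (P := P) Y F
    have h1 : condProb P Y F =ᵐ[P] P[F.indicator fun _ => (1 : ℝ) | A ⊔ B] := by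
      refine ae_eq_condExp_of_forall_setIntegral_eq hABm j₁
        (fun _ _ _ => j₂.integrableOn) (fun E hE _ => ?_)
        ((stronglyMeasurable_condProb Y F).mono hYAB).aestronglyMeasurable
      rw [← sub_eq_zero, ← integral_sub j₂.integrableOn j₁.integrableOn]
      refine setIntegral_eq_zero_of_sup hAm hBm (j₂.sub j₁) (fun G H hG hH => ?_) hE
      simp only [Pi.sub_apply]
      rw [integral_sub j₂.integrableOn j₁.integrableOn, hzero G H hG hH,
        setIntegral_indicator_one hFm, Set.inter_assoc, Set.inter_comm, sub_self]
    rwa [condExp_of_stronglyMeasurable hABm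
      (stronglyMeasurable_const.indicator hFAB) j₁] at h1
  refine measurableSet_of_ae_eq_s17 hcY hYm hFm
    ((stronglyMeasurable_condProb (P := P) Y F).measurable (measurableSet_singleton 1)) ?_
  filter_upwards [hae] with ω hω
  refine propext (?_ : ω ∈ F ↔ condProb P Y F ω = 1)
  rw [hω]
  by_cases h : ω ∈ F <;> simp [h]
end
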